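/- arXiv:2604.05486 — 2 statements merged into one kernel-verified Lean document; each statement's English description precedes it below -/
import Mathlib

section
/- Let φ : ℝ^N → ℝ be a smooth function with compact support contained in Ω, with φ ≥ 0, and normalized so that ρ(φ) = 1 (i.e. ∫_Ω ‖∇φ(x)‖^p dx + ∬_{ℝ^N×ℝ^N} |φ(x)−φ(y)|^p/‖x−y‖^{N+sp} dx dy = 1). Let f : ℝ → ℝ be continuous, F(t) = ∫_0^t f(τ) dτ, and assume there are constants A₁, C₁ > 0 such that F(t) ≥ A₁(t^{q+1} − C₁) for all t ≥ 0. Set c = (2 p^{-1} A₁^{-1} ‖φ‖_{L^{q+1}(Ω)}^{-(q+1)})^r and λ₁ = (c^p/(p A₁ C₁ |Ω|))^{1/(rp+1)}. Then for every λ ∈ (0, λ₁) one has E_λ(c λ^{-r} φ) ≤ 0. -/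
open MeasureTheory

/-- `ρ(u)^p = ∫_Ω ‖∇u‖^p dx + ∬_{ℝ^N×ℝ^N} |u(x)−u(y)|^p/‖x−y‖^{N+sp} dx dy`. -/
noncomputable def rhoPow (N : ℕ) (s p : ℝ) (Ω : Set (EuclideanSpace ℝ (Fin N)))
    (u : EuclideanSpace ℝ (Fin N) → ℝ) : ℝ :=
  (∫ x in Ω, ‖gradient u x‖ ^ p) +
    ∫ x, ∫ y, |u x - u y| ^ p / ‖x - y‖ ^ ((N : ℝ) + s * p)

/-- The energy functional `E_λ(u) = (1/p) ρ(u)^p − λ ∫_Ω F(u(x)) dx`. -/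
noncomputable def energy (N : ℕ) (s p : ℝ) (Ω : Set (EuclideanSpace ℝ (Fin N)))
    (F : ℝ → ℝ) (lam : ℝ) (u : EuclideanSpace ℝ (Fin N) → ℝ) : ℝ :=
  (1 / p) * rhoPow N s p Ω u - lam * ∫ x in Ω, F (u x)

lemma rhoPow_const_mul {N : ℕ} (s p : ℝ) (Ω : Set (EuclideanSpace ℝ (Fin N)))
    {u : EuclideanSpace ℝ (Fin N) → ℝ} (hu : Differentiable ℝ u) {k : ℝ} (hk : 0 ≤ k) :
    rhoPow N s p Ω (fun x => k * u x) = k ^ p * rhoPow N s p Ω u := by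
  have hgrad (x : EuclideanSpace ℝ (Fin N)) :
      ‖gradient (fun y => k * u y) x‖ ^ p = k ^ p * ‖gradient u x‖ ^ p := by
    have h : fderiv ℝ (fun y => k * u y) x = k • fderiv ℝ u x := fderiv_const_mul (hu x) k
    rw [gradient, gradient, LinearIsometryEquiv.norm_map, LinearIsometryEquiv.norm_map, h,
      norm_smul, Real.norm_of_nonneg hk, Real.mul_rpow hk (norm_nonneg _)]
  have hquot (x y : EuclideanSpace ℝ (Fin N)) :
      |k * u x - k * u y| ^ p / ‖x - y‖ ^ ((N : ℝ) + s * p) =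
        k ^ p * (|u x - u y| ^ p / ‖x - y‖ ^ ((N : ℝ) + s * p)) := by
    rw [← mul_sub, abs_mul, abs_of_nonneg hk, Real.mul_rpow hk (abs_nonneg _), mul_div_assoc]
  simp only [rhoPow, hgrad, hquot, integral_const_mul, mul_add]

lemma integrableOn_of_isBounded {N : ℕ} {Ω : Set (EuclideanSpace ℝ (Fin N))}
    (hΩ : Bornology.IsBounded Ω) {g : EuclideanSpace ℝ (Fin N) → ℝ} (hg : Continuous g) :
    IntegrableOn g Ω volume :=
  (hg.continuousOn.integrableOn_compact hΩ.isCompact_closure).mono_set subset_closure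

/-- The scalar inequality `k ^ p / p + λ A C m ≤ λ A k ^ (q + 1) I` at `k = c λ ^ (-r)`. -/
lemma scaled_power_bound {p q r A C m I c lam : ℝ} (hp : 1 < p) (hq : p - 1 < q)
    (hr : r = 1 / (q + 1 - p)) (hA : 0 < A) (hC : 0 < C) (hm : 0 < m) (hI : 0 < I)
    (hc : c = (2 * p⁻¹ * A⁻¹ * I⁻¹) ^ r) (hlam : 0 < lam)
    (hlt : lam < (c ^ p / (p * A * C * m)) ^ (1 / (r * p + 1))) :
    1 / p * (c * lam ^ (-r)) ^ p + lam * (A * C * m) ≤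
      lam * (A * ((c * lam ^ (-r)) ^ (q + 1) * I)) := by
  have hp0 : 0 < p := by linarith
  have hd : 0 < q + 1 - p := by linarith
  have hr0 : 0 < r := by rw [hr]; positivity
  have hrd : r * (q + 1 - p) = 1 := by rw [hr]; field_simp
  have hb : 0 < 2 * p⁻¹ * A⁻¹ * I⁻¹ := by positivity
  have hc0 : 0 < c := by rw [hc]; positivity
  have hcpow : c ^ (q + 1) = c ^ p * (2 * p⁻¹ * A⁻¹ * I⁻¹) := by
    have h : c ^ (q + 1 - p) = 2 * p⁻¹ * A⁻¹ * I⁻¹ := by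
      rw [hc, ← Real.rpow_mul hb.le, hrd, Real.rpow_one]
    rw [← h, ← Real.rpow_add hc0]
    congr 1
    ring
  have hlp : lam * lam ^ (-r * (q + 1)) = lam ^ (-r * p) := by
    nth_rewrite 1 [← Real.rpow_one lam]
    rw [← Real.rpow_add hlam]
    congr 1
    linarith
  have hsmall : lam ^ (r * p + 1) < c ^ p / (p * A * C * m) := by
    have h1 : 0 < r * p + 1 := by positivity
    have h := Real.rpow_lt_rpow hlam.le hlt h1
    rwa [← Real.rpow_mul (by positivity), one_div_mul_cancel h1.ne', Real.rpow_one] at h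
  have hbound : lam * (A * C * m) ≤ 1 / p * (c ^ p * lam ^ (-r * p)) := by
    rw [lt_div_iff₀ (by positivity)] at hsmall
    have hsplit : lam = lam ^ (r * p + 1) * lam ^ (-r * p) := by
      rw [← Real.rpow_add hlam]
      ring_nf
      rw [Real.rpow_one]
    have hpos : 0 < lam ^ (-r * p) := by positivity
    calc lam * (A * C * m)
        = 1 / p * (lam ^ (r * p + 1) * (p * A * C * m) * lam ^ (-r * p)) := by
          nth_rewrite 1 [hsplit]
          field_simp
      _ ≤ _ := by gcongr
  have hmain : lam * (A * ((c * lam ^ (-r)) ^ (q + 1) * I)) =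
      2 * (1 / p * (c ^ p * lam ^ (-r * p))) := by
    rw [Real.mul_rpow hc0.le (by positivity), ← Real.rpow_mul hlam.le, hcpow, ← hlp]
    field_simp
  rw [hmain, Real.mul_rpow hc0.le (by positivity), ← Real.rpow_mul hlam.le]
  linarith

/-- for `φ` smooth, compactly supported in `Ω`, nonnegative with
`ρ(φ) = 1`, `F(t) = ∫_0^t f ≥ A₁(t^{q+1} − C₁)` for `t ≥ 0`,
`c = (2 p⁻¹ A₁⁻¹ ‖φ‖_{L^{q+1}(Ω)}^{-(q+1)})^r` and
`λ₁ = (c^p/(p A₁ C₁ |Ω|))^{1/(rp+1)}`, one has `E_λ(c λ^{-r} φ) ≤ 0` for every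
`λ ∈ (0, λ₁)`. -/
theorem stmt_0 (N : ℕ) (hN : 2 < N) (Ω : Set (EuclideanSpace ℝ (Fin N)))
    (hΩo : IsOpen Ω) (hΩb : Bornology.IsBounded Ω)
    (hΩpos : 0 < volume Ω) (hΩfin : volume Ω < ⊤)
    (s p q r : ℝ) (hs : s ∈ Set.Ioo (0 : ℝ) 1) (hp : 1 < p) (hsp : s * p < N)
    (hq : p - 1 < q) (hr : r = 1 / (q + 1 - p))
    (φ : EuclideanSpace ℝ (Fin N) → ℝ)
    (hφsmooth : ContDiff ℝ (⊤ : ℕ∞) φ) (hφcpt : HasCompactSupport φ)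
    (hφsupp : tsupport φ ⊆ Ω) (hφnonneg : ∀ x, 0 ≤ φ x)
    (hgradint : IntegrableOn (fun x => ‖gradient φ x‖ ^ p) Ω volume)
    (hgagint : Integrable
      (fun z : EuclideanSpace ℝ (Fin N) × EuclideanSpace ℝ (Fin N) =>
        |φ z.1 - φ z.2| ^ p / ‖z.1 - z.2‖ ^ ((N : ℝ) + s * p)) (volume.prod volume))
    (hφnorm : rhoPow N s p Ω φ = 1)
    (f F : ℝ → ℝ) (hf : Continuous f)
    (hF : ∀ t : ℝ, F t = ∫ τ in (0:ℝ)..t, f τ)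
    (A₁ C₁ : ℝ) (hA₁ : 0 < A₁) (hC₁ : 0 < C₁)
    (hFlow : ∀ t : ℝ, 0 ≤ t → A₁ * (t ^ (q + 1) - C₁) ≤ F t)
    (c lam₁ : ℝ)
    (hc : c = (2 * p⁻¹ * A₁⁻¹ *
      ((∫ x in Ω, |φ x| ^ (q + 1)) ^ (1 / (q + 1))) ^ (-(q + 1))) ^ r)
    (hlam₁ : lam₁ = (c ^ p / (p * A₁ * C₁ * (volume Ω).toReal)) ^ (1 / (r * p + 1))) :
    ∀ lam : ℝ, 0 < lam → lam < lam₁ →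
      energy N s p Ω F lam (fun x => c * lam ^ (-r) * φ x) ≤ 0 := by
  intro lam hlam hlt
  have hp0 : 0 < p := by linarith
  have hq1 : 0 < q + 1 := by linarith
  have hd : 0 < q + 1 - p := by linarith
  have hr0 : 0 < r := by rw [hr]; positivity
  have hm : 0 < (volume Ω).toReal := ENNReal.toReal_pos hΩpos.ne' hΩfin.ne
  set I : ℝ := ∫ x in Ω, |φ x| ^ (q + 1)
  have hI0 : 0 ≤ I := integral_nonneg fun x => by positivity
  have hpow : (I ^ (1 / (q + 1))) ^ (-(q + 1)) = I⁻¹ := by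
    rw [Real.rpow_neg (by positivity), ← Real.rpow_mul hI0, one_div_mul_cancel hq1.ne',
      Real.rpow_one]
  rw [hpow] at hc
  have hI : 0 < I := by
    refine hI0.lt_of_ne fun h => ?_
    have hc0 : c = 0 := by rw [hc, ← h, inv_zero, mul_zero, Real.zero_rpow hr0.ne']
    have h1 : 0 < r * p + 1 := by positivity
    rw [hlam₁, hc0, Real.zero_rpow hp0.ne', zero_div, Real.zero_rpow (by positivity)] at hlt
    exact hlt.not_gt hlam
  rw [hlam₁] at hlt
  have hbound := scaled_power_bound hp hq hr hA₁ hC₁ hm hI hc hlam hlt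
  have hk : 0 ≤ c * lam ^ (-r) := by rw [hc]; positivity
  set k : ℝ := c * lam ^ (-r)
  have hFcont : Continuous F := by
    rw [funext hF]
    exact intervalIntegral.continuous_primitive (fun a b => hf.intervalIntegrable a b) 0
  have hφcont : Continuous φ := hφsmooth.continuous
  have hpint : IntegrableOn (fun x => |φ x| ^ (q + 1)) Ω volume :=
    integrableOn_of_isBounded hΩb (hφcont.abs.rpow_const fun _ => Or.inr hq1.le)
  have hconst : IntegrableOn (fun _ : EuclideanSpace ℝ (Fin N) => C₁) Ω volume :=
    integrableOn_const hΩfin.ne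
  have hlower : A₁ * (k ^ (q + 1) * I - C₁ * (volume Ω).toReal) ≤ ∫ x in Ω, F (k * φ x) := by
    calc A₁ * (k ^ (q + 1) * I - C₁ * (volume Ω).toReal)
        = ∫ x in Ω, A₁ * (k ^ (q + 1) * |φ x| ^ (q + 1) - C₁) := by
          rw [integral_const_mul, integral_sub (hpint.const_mul _) hconst, integral_const_mul,
            setIntegral_const, smul_eq_mul, mul_comm C₁]
          rfl
      _ ≤ _ := by
          refine integral_mono (((hpint.const_mul _).sub hconst).const_mul _)
            (integrableOn_of_isBounded hΩb (hFcont.comp (continuous_const.mul hφcont)))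
            fun x => ?_
          have h := hFlow (k * φ x) (mul_nonneg hk (hφnonneg x))
          simpa only [Real.mul_rpow hk (hφnonneg x), abs_of_nonneg (hφnonneg x)] using h
  rw [energy, rhoPow_const_mul s p Ω (hφsmooth.differentiable (by simp)) hk, hφnorm, mul_one]
  have := mul_le_mul_of_nonneg_left hlower hlam.le
  linarith
end

section
/- Let f : ℝ → ℝ be continuous, F(t) = ∫_0^t f(τ) dτ, and assume there is a constant B₁ > 0 such that F(t) ≤ B₁(|t|^{q+1} + 1) for all t ∈ ℝ. Let S₁ > 0 be a constant, let τ > 0 satisfy τ ≤ (2 p S₁^{q+1} B₁)^{-r}, set c₁ = 1/(4p) and λ₂ = (τ^p/(4 p B₁ |Ω|))^{1/(1+rp)}. Then for every λ ∈ (0, λ₂) and every differentiable u : ℝ^N → ℝ vanishing outside Ω with ρ(u) finite, such that ‖u‖_{L^{q+1}(Ω)} ≤ S₁ ρ(u) and ρ(u) = τ λ^{-r}, one has E_λ(u) ≥ c₁ (τ λ^{-r})^p. -/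
open MeasureTheory

/-- `ρ(u) = (ρ(u)^p)^{1/p}`. -/
noncomputable def rho (N : ℕ) (s p : ℝ) (Ω : Set (EuclideanSpace ℝ (Fin N)))
    (u : EuclideanSpace ℝ (Fin N) → ℝ) : ℝ :=
  (rhoPow N s p Ω u) ^ (1 / p)

/-- The power term of the growth bound on a sphere of radius `τ * l ^ (-r)`, `r = 1 / (q + 1 - p)`,
absorbs at most half of the principal term. -/
theorem mul_rpow_radius_le {p q r S B τ l : ℝ} (hp : 0 < p) (hq : p - 1 < q)
    (hr : r = 1 / (q + 1 - p)) (hS : 0 < S) (hB : 0 < B) (hτ0 : 0 < τ)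
    (hτ : τ ≤ (2 * p * S ^ (q + 1) * B) ^ (-r)) (hl : 0 < l) :
    l * (B * (S * (τ * l ^ (-r))) ^ (q + 1)) ≤ 1 / (2 * p) * (τ * l ^ (-r)) ^ p := by
  have hd : 0 < q + 1 - p := by linarith
  have hrd : -r * (q + 1 - p) = -1 := by rw [hr]; field_simp
  have hR : 0 < τ * l ^ (-r) := by positivity
  have hK : 0 < 2 * p * S ^ (q + 1) * B := by positivity
  have hτd : τ ^ (q + 1 - p) ≤ (2 * p * S ^ (q + 1) * B)⁻¹ := by
    calc τ ^ (q + 1 - p) ≤ ((2 * p * S ^ (q + 1) * B) ^ (-r)) ^ (q + 1 - p) :=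
          Real.rpow_le_rpow hτ0.le hτ hd.le
      _ = _ := by rw [← Real.rpow_mul hK.le, hrd, Real.rpow_neg_one]
  have hRd : (τ * l ^ (-r)) ^ (q + 1 - p) = τ ^ (q + 1 - p) * l⁻¹ := by
    rw [Real.mul_rpow hτ0.le (by positivity), ← Real.rpow_mul hl.le, hrd, Real.rpow_neg_one]
  have hsplit : (τ * l ^ (-r)) ^ (q + 1) = τ ^ (q + 1 - p) * l⁻¹ * (τ * l ^ (-r)) ^ p := by
    rw [← hRd, ← Real.rpow_add hR]
    congr 1
    ring
  rw [Real.mul_rpow hS.le hR.le, hsplit]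
  calc l * (B * (S ^ (q + 1) * (τ ^ (q + 1 - p) * l⁻¹ * (τ * l ^ (-r)) ^ p)))
      = B * S ^ (q + 1) * τ ^ (q + 1 - p) * (τ * l ^ (-r)) ^ p := by field_simp
    _ ≤ B * S ^ (q + 1) * (2 * p * S ^ (q + 1) * B)⁻¹ * (τ * l ^ (-r)) ^ p := by gcongr
    _ = 1 / (2 * p) * (τ * l ^ (-r)) ^ p := by
      have : S ^ (q + 1) ≠ 0 := by positivity
      field_simp

/-- The constant term of the growth bound absorbs at most a quarter of the principal term when `l`
is small. -/
theorem mul_le_rpow_radius {p r B V τ l : ℝ} (hp : 0 < p) (hr : 0 < r) (hB : 0 < B) (hV : 0 < V)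
    (hτ : 0 < τ) (hl : 0 < l) (hlt : l < (τ ^ p / (4 * p * B * V)) ^ (1 / (1 + r * p))) :
    l * (B * V) ≤ 1 / (4 * p) * (τ * l ^ (-r)) ^ p := by
  have he : 0 < 1 + r * p := by positivity
  have hpow : l ^ (1 + r * p) ≤ τ ^ p / (4 * p * B * V) := by
    have h := Real.rpow_le_rpow hl.le hlt.le he.le
    rwa [← Real.rpow_mul (by positivity), one_div_mul_cancel he.ne', Real.rpow_one] at h
  rw [Real.rpow_add hl, Real.rpow_one, le_div_iff₀ (by positivity)] at hpow
  rw [Real.mul_rpow hτ.le (by positivity), ← Real.rpow_mul hl.le, neg_mul, Real.rpow_neg hl.le]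
  have hlp : 0 < l ^ (r * p) := by positivity
  rw [← div_eq_mul_inv, one_div_mul_eq_div, div_div, le_div_iff₀ (by positivity)]
  linarith

theorem rhoPow_nonneg (N : ℕ) (s p : ℝ) (Ω : Set (EuclideanSpace ℝ (Fin N)))
    (u : EuclideanSpace ℝ (Fin N) → ℝ) : 0 ≤ rhoPow N s p Ω u :=
  add_nonneg (integral_nonneg fun _ => by positivity)
    (integral_nonneg fun _ => integral_nonneg fun _ => by positivity)

theorem rho_rpow (N : ℕ) (s : ℝ) {p : ℝ} (hp : p ≠ 0) (Ω : Set (EuclideanSpace ℝ (Fin N)))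
    (u : EuclideanSpace ℝ (Fin N) → ℝ) : rho N s p Ω u ^ p = rhoPow N s p Ω u := by
  rw [rho, ← Real.rpow_mul (rhoPow_nonneg N s p Ω u), one_div_mul_cancel hp, Real.rpow_one]

/-- if `F(t) = ∫_0^t f ≤ B₁(|t|^{q+1} + 1)`, `τ ≤ (2 p S₁^{q+1} B₁)^{-r}`,
`c₁ = 1/(4p)` and `λ₂ = (τ^p/(4 p B₁ |Ω|))^{1/(1+rp)}`, then for every `λ ∈ (0, λ₂)`
and every admissible `u` with `‖u‖_{L^{q+1}(Ω)} ≤ S₁ ρ(u)` and `ρ(u) = τ λ^{-r}`,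
one has `E_λ(u) ≥ c₁ (τ λ^{-r})^p`. -/
theorem stmt_2 (N : ℕ) (hN : 2 < N) (Ω : Set (EuclideanSpace ℝ (Fin N)))
    (hΩo : IsOpen Ω) (hΩb : Bornology.IsBounded Ω)
    (hΩpos : 0 < volume Ω) (hΩfin : volume Ω < ⊤)
    (s p q r : ℝ) (hs : s ∈ Set.Ioo (0 : ℝ) 1) (hp : 1 < p) (hsp : s * p < N)
    (hq : p - 1 < q) (hr : r = 1 / (q + 1 - p))
    (f F : ℝ → ℝ) (hf : Continuous f)
    (hF : ∀ t : ℝ, F t = ∫ τ in (0:ℝ)..t, f τ)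
    (B₁ : ℝ) (hB₁ : 0 < B₁)
    (hFup : ∀ t : ℝ, F t ≤ B₁ * (|t| ^ (q + 1) + 1))
    (S₁ : ℝ) (hS₁ : 0 < S₁)
    (τ : ℝ) (hτpos : 0 < τ) (hτ : τ ≤ (2 * p * S₁ ^ (q + 1) * B₁) ^ (-r))
    (c₁ lam₂ : ℝ) (hc₁ : c₁ = 1 / (4 * p))
    (hlam₂ : lam₂ = (τ ^ p / (4 * p * B₁ * (volume Ω).toReal)) ^ (1 / (1 + r * p))) :
    ∀ lam : ℝ, 0 < lam → lam < lam₂ →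
      ∀ u : EuclideanSpace ℝ (Fin N) → ℝ, Differentiable ℝ u →
        (∀ x ∉ Ω, u x = 0) →
        IntegrableOn (fun x => ‖gradient u x‖ ^ p) Ω volume →
        Integrable
          (fun z : EuclideanSpace ℝ (Fin N) × EuclideanSpace ℝ (Fin N) =>
            |u z.1 - u z.2| ^ p / ‖z.1 - z.2‖ ^ ((N : ℝ) + s * p)) (volume.prod volume) →
        IntegrableOn (fun x => |u x| ^ (q + 1)) Ω volume →
        IntegrableOn (fun x => F (u x)) Ω volume →
        (∫ x in Ω, |u x| ^ (q + 1)) ^ (1 / (q + 1)) ≤ S₁ * rho N s p Ω u →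
        rho N s p Ω u = τ * lam ^ (-r) →
        c₁ * (τ * lam ^ (-r)) ^ p ≤ energy N s p Ω F lam u := by
  intro l hl hlt u _ _ _ _ hu hFu hSob hsphere
  have hp0 : 0 < p := by linarith
  have hq1 : 0 < q + 1 := by linarith
  have hr0 : 0 < r := by rw [hr]; exact one_div_pos.mpr (by linarith)
  have hV : 0 < (volume Ω).toReal := ENNReal.toReal_pos hΩpos.ne' hΩfin.ne
  have hint : ∫ x in Ω, |u x| ^ (q + 1) ≤ (S₁ * (τ * l ^ (-r))) ^ (q + 1) := by
    have h0 : 0 ≤ ∫ x in Ω, |u x| ^ (q + 1) := integral_nonneg fun _ => by positivity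
    rw [hsphere] at hSob
    have h := Real.rpow_le_rpow (by positivity) hSob hq1.le
    rwa [← Real.rpow_mul h0, one_div_mul_cancel hq1.ne', Real.rpow_one] at h
  have hconst : IntegrableOn (fun _ => (1 : ℝ)) Ω volume := integrableOn_const hΩfin.ne
  have hFint : ∫ x in Ω, F (u x) ≤
      B₁ * ((S₁ * (τ * l ^ (-r))) ^ (q + 1) + (volume Ω).toReal) := by
    calc ∫ x in Ω, F (u x) ≤ ∫ x in Ω, B₁ * (|u x| ^ (q + 1) + 1) :=
          integral_mono hFu ((hu.add hconst).const_mul B₁) fun x => hFup (u x)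
      _ = B₁ * ((∫ x in Ω, |u x| ^ (q + 1)) + (volume Ω).toReal) := by
        rw [integral_const_mul, integral_add hu hconst]
        simp [Measure.real]
      _ ≤ _ := by gcongr
  have hpower := mul_rpow_radius_le hp0 hq hr hS₁ hB₁ hτpos hτ hl
  have hvol := mul_le_rpow_radius hp0 hr0 hB₁ hV hτpos hl (hlam₂ ▸ hlt)
  have hlF := mul_le_mul_of_nonneg_left hFint hl.le
  rw [energy, ← rho_rpow N s hp0.ne' Ω u, hsphere, hc₁]
  have hquarters : 1 / p * (τ * l ^ (-r)) ^ p =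
      1 / (4 * p) * (τ * l ^ (-r)) ^ p + 1 / (4 * p) * (τ * l ^ (-r)) ^ p +
        1 / (2 * p) * (τ * l ^ (-r)) ^ p := by
    field_simp
    ring
  linarith
end
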